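/- Fix a desired view k_i with 2 ≤ k_i ≤ M−1. For 1 ≤ k ≤ R−1 with k ≤ k_i−1, let B_k be the event that view k_i−k is received, none of the views k_i−1, …, k_i−(k−1) is received, and none of the views k_i+1, …, k_i+min(R−k, M−k_i) is received; let B_0 be the event that none of the views k_i−1, …, k_i−min(R−1, k_i−1) is received (and let B_k be the empty event when k > k_i−1). Then the events B_0, B_1, …, B_{R−1} are pairwise disjoint, and their union equals the event that there exists no pair of received views l, r with l < k_i < r and r − l ≤ R (i.e., the event that view k_i cannot be synthesized by DIBR). -/

import Mathlib

open Finset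

/-- The event that view `k` can be synthesized via DIBR: some left view `l` and right view `r`
with `1 ≤ l < k < r ≤ M` and `r - l ≤ R` are both received. -/
def synthEvent {Ω : Type*} (Recv : ℕ → Set Ω) (M R k : ℕ) : Set Ω :=
  ⋃ (l : ℕ) (r : ℕ) (_ : 1 ≤ l) (_ : l < k) (_ : k < r) (_ : r ≤ M) (_ : r - l ≤ R),
    Recv l ∩ Recv r

/-- The events `B_k`, `0 ≤ k ≤ R - 1`:
`B_0` is the event that none of the left views of `kI` within DIBR range is received;
for `1 ≤ k ≤ kI - 1`, `B_k` is the event that view `kI - k` is received, none of the views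
`kI - 1, …, kI - (k-1)` is received, and none of the views
`kI + 1, …, kI + min (R - k) (M - kI)` is received; and `B_k = ∅` when `k > kI - 1`. -/
def Bevent {Ω : Type*} (Recv : ℕ → Set Ω) (M R kI k : ℕ) : Set Ω :=
  if k = 0 then ⋂ j ∈ Finset.Icc 1 (min (R - 1) (kI - 1)), (Recv (kI - j))ᶜ
  else if k ≤ kI - 1 then
    Recv (kI - k) ∩ (⋂ j ∈ Finset.Icc 1 (k - 1), (Recv (kI - j))ᶜ) ∩
      (⋂ l ∈ Finset.Icc 1 (min (R - k) (M - kI)), (Recv (kI + l))ᶜ)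
  else ∅

theorem mem_synthEvent {Ω : Type*} {Recv : ℕ → Set Ω} {M R k : ℕ} {ω : Ω} :
    ω ∈ synthEvent Recv M R k ↔
      ∃ l r, 1 ≤ l ∧ l < k ∧ k < r ∧ r ≤ M ∧ r - l ≤ R ∧ ω ∈ Recv l ∧ ω ∈ Recv r := by
  simp only [synthEvent, Set.mem_iUnion, Set.mem_inter_iff, exists_prop]

theorem mem_Bevent_zero {Ω : Type*} {Recv : ℕ → Set Ω} {M R kI : ℕ} {ω : Ω} :
    ω ∈ Bevent Recv M R kI 0 ↔
      ∀ j, 1 ≤ j → j ≤ R - 1 → j ≤ kI - 1 → ω ∉ Recv (kI - j) := by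
  simp [Bevent]

theorem mem_Bevent_of_ne_zero {Ω : Type*} {Recv : ℕ → Set Ω} {M R kI k : ℕ} {ω : Ω}
    (hk : k ≠ 0) :
    ω ∈ Bevent Recv M R kI k ↔
      k ≤ kI - 1 ∧ ω ∈ Recv (kI - k) ∧ (∀ j, 1 ≤ j → j ≤ k - 1 → ω ∉ Recv (kI - j)) ∧
        ∀ j, 1 ≤ j → j ≤ R - k → j ≤ M - kI → ω ∉ Recv (kI + j) := by
  by_cases h : k ≤ kI - 1 <;> simp [Bevent, hk, h, and_assoc]

theorem disjoint_Bevent_of_lt {Ω : Type*} (Recv : ℕ → Set Ω) (M : ℕ) {R kI k k' : ℕ}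
    (hk' : k' ≤ R - 1) (h : k < k') :
    Disjoint (Bevent Recv M R kI k) (Bevent Recv M R kI k') := by
  rw [Set.disjoint_left]
  intro ω hω hω'
  obtain ⟨hle, hrecv, hnot, -⟩ := (mem_Bevent_of_ne_zero (by omega)).1 hω'
  rcases eq_or_ne k 0 with rfl | hk
  · exact mem_Bevent_zero.1 hω k' h hk' hle hrecv
  · exact hnot k (by omega) (by omega) ((mem_Bevent_of_ne_zero hk).1 hω).2.1

theorem iUnion_Bevent_subset {Ω : Type*} (Recv : ℕ → Set Ω) (M R kI : ℕ) :
    (⋃ k ∈ Finset.Icc 0 (R - 1), Bevent Recv M R kI k) ⊆ (synthEvent Recv M R kI)ᶜ := by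
  intro ω hω hs
  simp only [Set.mem_iUnion] at hω
  obtain ⟨k, -, hB⟩ := hω
  obtain ⟨l, r, hl, hlk, hkr, hrM, hlr, hωl, hωr⟩ := mem_synthEvent.1 hs
  have hl' : kI - (kI - l) = l := by omega
  have hr' : kI + (r - kI) = r := by omega
  rcases eq_or_ne k 0 with rfl | hk
  · exact mem_Bevent_zero.1 hB (kI - l) (by omega) (by omega) (by omega) (hl'.symm ▸ hωl)
  · obtain ⟨-, -, hleft, hright⟩ := (mem_Bevent_of_ne_zero hk).1 hB
    by_cases hc : kI - l ≤ k - 1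
    · exact hleft (kI - l) (by omega) hc (hl'.symm ▸ hωl)
    · exact hright (r - kI) (by omega) (by omega) (by omega) (hr'.symm ▸ hωr)

theorem compl_synthEvent_subset {Ω : Type*} (Recv : ℕ → Set Ω) (M R kI : ℕ) :
    (synthEvent Recv M R kI)ᶜ ⊆ ⋃ k ∈ Finset.Icc 0 (R - 1), Bevent Recv M R kI k := by
  classical
  intro ω hω
  simp only [Set.mem_iUnion, Finset.mem_Icc, exists_prop]
  by_cases hex : ∃ j, 1 ≤ j ∧ j ≤ R - 1 ∧ j ≤ kI - 1 ∧ ω ∈ Recv (kI - j)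
  · obtain ⟨h1, h2, h3, h4⟩ := Nat.find_spec hex
    have hmin : ∀ j < Nat.find hex, _ := fun j hj => Nat.find_min hex hj
    generalize Nat.find hex = k at *
    refine ⟨k, ⟨by omega, h2⟩, (mem_Bevent_of_ne_zero (by omega)).2 ⟨h3, h4, ?_, ?_⟩⟩
    · intro j hj hjk hrecv
      exact hmin j (by omega) ⟨hj, by omega, by omega, hrecv⟩
    · intro j hj hjR hjM hrecv
      exact hω (mem_synthEvent.2 ⟨kI - k, kI + j, by omega, by omega, by omega, by omega,
        by omega, h4, hrecv⟩)
  · exact ⟨0, by omega, mem_Bevent_zero.2 fun j h1 h2 h3 h4 => hex ⟨j, h1, h2, h3, h4⟩⟩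

/-- The events `B_0, B_1, …, B_{R-1}` are pairwise disjoint and their union is exactly the
event that view `kI` cannot be synthesized by DIBR. -/
theorem Bevents_disjoint_union
    {Ω : Type*} (Recv : ℕ → Set Ω) (M R kI : ℕ)
    (hR : 1 ≤ R) (hk2 : 2 ≤ kI) (hkM : kI ≤ M - 1) :
    (∀ k ∈ Finset.Icc 0 (R - 1), ∀ k' ∈ Finset.Icc 0 (R - 1), k ≠ k' →
      Disjoint (Bevent Recv M R kI k) (Bevent Recv M R kI k')) ∧
    (⋃ k ∈ Finset.Icc 0 (R - 1), Bevent Recv M R kI k) = (synthEvent Recv M R kI)ᶜ := by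
  refine ⟨fun k hk k' hk' hne => ?_, (iUnion_Bevent_subset Recv M R kI).antisymm
    (compl_synthEvent_subset Recv M R kI)⟩
  rcases lt_or_gt_of_ne hne with h | h
  · exact disjoint_Bevent_of_lt Recv M (Finset.mem_Icc.1 hk').2 h
  · exact (disjoint_Bevent_of_lt Recv M (Finset.mem_Icc.1 hk).2 h).symm
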